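/- arXiv:1408.0451 — 2 statements merged into one kernel-verified Lean document; each statement's English description precedes it below -/
import Mathlib

section
/- If w is a nonempty finite word such that |w| + 2 = R_w + K_w + |Alph(w)|, then w is a generalized trapezoidal word. -/
open List

variable {A : Type*} [DecidableEq A]

/-- The alphabet of a word: the finite set of distinct letters occurring in it. -/
def Alph (w : List A) : Finset A := w.toFinset

/-- The finset of all factors (contiguous subwords) of `w`. -/
def factors (w : List A) : Finset (List A) :=
  ((Finset.range (w.length + 1)) ×ˢ (Finset.range (w.length + 1))).image
    (fun p => (w.drop p.1).take p.2)

/-- Factor complexity: the number of distinct factors of `w` of length `n`. -/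
def C (w : List A) (n : ℕ) : ℕ := ((factors w).filter (fun u => u.length = n)).card

/-- Right-valence of `u` in `w`: the number of distinct letters `x` such that `u ++ [x]`
is a factor of `w`. -/
def rightValence (w u : List A) : ℕ := ((Alph w).filter (fun x => u ++ [x] <:+: w)).card

/-- `u` is a right special factor of `w`. -/
def RightSpecial (w u : List A) : Prop := u <:+: w ∧ 2 ≤ rightValence w u

/-- `R w`: the smallest positive integer `r` such that `w` has no right special factor
of length `r`. -/
noncomputable def R (w : List A) : ℕ :=
  sInf {r : ℕ | 0 < r ∧ ∀ u : List A, u.length = r → ¬ RightSpecial w u}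

/-- The number of occurrences of `u` as a factor of `w`. -/
def occCount (w u : List A) : ℕ :=
  ((Finset.range (w.length + 1)).filter
    (fun i => i + u.length ≤ w.length ∧ (w.drop i).take u.length = u)).card

/-- `K w`: the length of the shortest suffix of `w` occurring exactly once in `w`. -/
noncomputable def K (w : List A) : ℕ :=
  sInf {k : ℕ | ∃ u : List A, u <:+ w ∧ u.length = k ∧ occCount w u = 1}

/-- Left-valence of `u` in `w`. -/
def leftValence (w u : List A) : ℕ := ((Alph w).filter (fun x => x :: u <:+: w)).card

/-- `u` is a left special factor of `w`. -/
def LeftSpecial (w u : List A) : Prop := u <:+: w ∧ 2 ≤ leftValence w u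

/-- `L w`: the smallest positive integer `ℓ` such that `w` has no left special factor
of length `ℓ`. -/
noncomputable def L (w : List A) : ℕ :=
  sInf {r : ℕ | 0 < r ∧ ∀ u : List A, u.length = r → ¬ LeftSpecial w u}

/-- `H w`: the length of the shortest prefix of `w` occurring exactly once in `w`. -/
noncomputable def H (w : List A) : ℕ :=
  sInf {k : ℕ | ∃ u : List A, u <+: w ∧ u.length = k ∧ occCount w u = 1}

/-- A generalized trapezoidal word. -/
def IsGT (w : List A) : Prop :=
  w ≠ [] ∧ ((Alph w).card = 1 ∨
    ∃ m M : ℕ, 0 < m ∧ m ≤ M ∧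
      (∀ i, 1 ≤ i → i ≤ m → C w i = (Alph w).card + i - 1) ∧
      (∀ i, m ≤ i → i ≤ M - 1 → C w (i + 1) = C w i) ∧
      (∀ i, M ≤ i → i ≤ w.length → C w (i + 1) = C w i - 1))

/-- The heart of a word: remove the longest prefix and longest suffix consisting of
letters that occur exactly once in the word (if some letter repeats); otherwise the
word itself. -/
def heart (w : List A) : List A :=
  if ∀ x ∈ w, w.count x = 1 then w
  else
    ((w.dropWhile (fun x => w.count x == 1)).reverse.dropWhile
      (fun x => w.count x == 1)).reverse

/-- A word is rich if it has exactly `|w| + 1` distinct palindromic factors. -/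
def Rich (w : List A) : Prop :=
  ((factors w).filter (fun u => u.reverse = u)).card = w.length + 1

/-- `p` is a period of `w`. -/
def IsPeriod (w : List A) (p : ℕ) : Prop :=
  0 < p ∧ ∀ i : ℕ, i + p < w.length → w[i]? = w[i + p]?

/-- The minimal period of `w`. -/
noncomputable def minPeriod (w : List A) : ℕ := sInf {p : ℕ | IsPeriod w p}

theorem mem_factors_iff {A : Type*} [DecidableEq A] (w u : List A) :
    u ∈ factors w ↔ u <:+: w := by
  unfold factors
  simp only [Finset.mem_image, Finset.mem_product, Finset.mem_range, Prod.exists]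
  constructor
  · rintro ⟨a, b, -, rfl⟩
    exact (List.take_prefix _ _).isInfix.trans (List.drop_suffix _ _).isInfix
  · rintro ⟨s, t, rfl⟩
    refine ⟨s.length, u.length, ⟨?_, ?_⟩, ?_⟩
    · simp
    · simp; omega
    · simp

theorem rv_zero_iff {A : Type*} [DecidableEq A] (w u : List A) :
    rightValence w u = 0 ↔ ∀ x, ¬ (u ++ [x] <:+: w) := by
  unfold rightValence Alph
  rw [Finset.card_eq_zero, Finset.filter_eq_empty_iff]
  constructor
  · intro h x hx
    refine h ?_ hx
    rw [List.mem_toFinset]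
    exact hx.subset (by simp)
  · intro h x _
    exact h x

theorem occ_one_iff {A : Type*} [DecidableEq A] (w u : List A) (hu : u <:+ w) :
    occCount w u = 1 ↔ ∀ x, ¬ (u ++ [x] <:+: w) := by
  unfold occCount
  have hlen := hu.length_le
  have hmem : w.length - u.length ∈ (Finset.range (w.length + 1)).filter
    (fun i => i + u.length ≤ w.length ∧ (w.drop i).take u.length = u) := by
    simp only [Finset.mem_filter, Finset.mem_range]
    refine ⟨by omega, by omega, ?_⟩
    rw [← List.suffix_iff_eq_drop.1 hu]
    simp
  constructor
  · rintro h x ⟨s, t, hst⟩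
    have hl : s.length + u.length + 1 ≤ w.length := by
      rw [← hst]; simp
    have h2 : s.length ∈ (Finset.range (w.length + 1)).filter
      (fun i => i + u.length ≤ w.length ∧ (w.drop i).take u.length = u) := by
      simp only [Finset.mem_filter, Finset.mem_range]
      refine ⟨by omega, by omega, ?_⟩
      rw [← hst]; simp
    have := Finset.card_le_one.1 h.le _ hmem _ h2
    omega
  · intro h
    rw [Finset.card_eq_one]
    refine ⟨w.length - u.length, ?_⟩
    refine Finset.eq_singleton_iff_unique_mem.2 ⟨hmem, ?_⟩
    intro i hi
    simp only [Finset.mem_filter, Finset.mem_range] at hi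
    obtain ⟨h1, h2, h3⟩ := hi
    by_contra hne
    have hlt : i + u.length < w.length := by omega
    apply h (w[i + u.length])
    have h4 : (w.drop i).take (u.length + 1) = u ++ [w[i + u.length]] := by
      rw [List.take_add_one, h3]
      simp [hlt]
    rw [← h4]
    exact (List.take_prefix _ _).isInfix.trans (List.drop_suffix _ _).isInfix

theorem K_mem {A : Type*} [DecidableEq A] (w : List A) :
    (∃ u : List A, u <:+ w ∧ u.length = K w ∧ occCount w u = 1) ∧ K w ≤ w.length := by
  have hw : w.length ∈ {k : ℕ | ∃ u : List A, u <:+ w ∧ u.length = k ∧ occCount w u = 1} := by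
    refine ⟨w, List.suffix_rfl, rfl, ?_⟩
    rw [occ_one_iff _ _ List.suffix_rfl]
    intro x hx
    have := hx.length_le
    simp at this
  exact ⟨Nat.sInf_mem ⟨_, hw⟩, Nat.sInf_le hw⟩

theorem K_pos {A : Type*} [DecidableEq A] (w : List A) (hw : w ≠ []) : 0 < K w := by
  obtain ⟨⟨u, h1, h2, h3⟩, -⟩ := K_mem w
  rw [← h2]
  rw [occ_one_iff _ _ h1] at h3
  by_contra h0
  have : u = [] := List.length_eq_zero_iff.1 (by omega)
  subst this
  obtain ⟨a, l, rfl⟩ := List.exists_cons_of_ne_nil hw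
  exact h3 a ⟨[], l, by simp⟩

theorem card_zero {A : Type*} [DecidableEq A] (w : List A) (i : ℕ) (hi : i ≤ w.length) :
    (((factors w).filter (fun u => u.length = i)).filter
      (fun u => rightValence w u = 0)).card = if K w ≤ i then 1 else 0 := by
  have hsub : ∀ u, u <:+: w → rightValence w u = 0 → u <:+ w := by
    rintro u ⟨s, t, rfl⟩ h
    rw [rv_zero_iff] at h
    cases t with
    | nil => exact ⟨s, by simp⟩
    | cons x t => exact absurd ⟨s, t, by simp⟩ (h x)
  split_ifs with hK
  · rw [Finset.card_eq_one]
    refine ⟨w.drop (w.length - i), Finset.eq_singleton_iff_unique_mem.2 ⟨?_, ?_⟩⟩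
    · simp only [Finset.mem_filter, mem_factors_iff, rv_zero_iff]
      refine ⟨⟨(List.drop_suffix _ _).isInfix, by simp; omega⟩, ?_⟩
      intro x hx
      obtain ⟨⟨s, h1, h2, h3⟩, -⟩ := K_mem w
      rw [occ_one_iff _ _ h1] at h3
      apply h3 x
      have hs : s <:+ w.drop (w.length - i) :=
        List.suffix_of_suffix_length_le h1 (List.drop_suffix _ _) (by simp; omega)
      obtain ⟨p, hp⟩ := hs
      refine List.IsInfix.trans ?_ hx
      exact ⟨p, [], by rw [← hp]; simp⟩
    · intro u hu
      simp only [Finset.mem_filter, mem_factors_iff] at hu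
      have := List.suffix_iff_eq_drop.1 (hsub u hu.1.1 hu.2)
      rw [this, hu.1.2]
  · rw [Finset.card_eq_zero, Finset.filter_eq_empty_iff]
    intro u hu h0
    simp only [Finset.mem_filter, mem_factors_iff] at hu
    apply hK
    have hs := hsub u hu.1 h0
    apply Nat.sInf_le
    exact ⟨u, hs, hu.2, (occ_one_iff _ _ hs).2 ((rv_zero_iff _ _).1 h0)⟩

theorem C_succ_sum {A : Type*} [DecidableEq A] (w : List A) (i : ℕ) :
    C w (i + 1) = ∑ u ∈ (factors w).filter (fun u => u.length = i), rightValence w u := by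
  unfold C
  rw [Finset.card_eq_sum_card_fiberwise (f := List.dropLast)
    (t := (factors w).filter (fun u => u.length = i))]
  · refine Finset.sum_congr rfl ?_
    intro u hu
    simp only [Finset.mem_filter, mem_factors_iff] at hu
    unfold rightValence
    symm
    apply Finset.card_bij (fun x _ => u ++ [x])
    · intro x hx
      simp only [Finset.mem_filter, mem_factors_iff] at hx ⊢
      exact ⟨⟨hx.2, by simp [hu.2]⟩, by simp⟩
    · intro a _ b _ hab
      simpa using hab
    · intro v hv
      simp only [Finset.mem_filter, mem_factors_iff] at hv
      have hne : v ≠ [] := by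
        intro h0; simp [h0] at hv
      have hv' : u ++ [v.getLast hne] = v := by
        rw [← hv.2]; exact List.dropLast_append_getLast hne
      refine ⟨v.getLast hne, ?_, hv'⟩
      simp only [Finset.mem_filter]
      refine ⟨?_, by rw [hv']; exact hv.1.1⟩
      unfold Alph
      rw [List.mem_toFinset]
      exact hv.1.1.subset (List.getLast_mem hne)
  · intro v hv
    simp only [Finset.coe_filter, Set.mem_ofPred_eq, mem_factors_iff] at hv ⊢
    exact ⟨(List.dropLast_prefix v).isInfix.trans hv.1, by simp [hv.2]⟩

/-- excess of right valence at length `i` -/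
def exc {A : Type*} [DecidableEq A] (w : List A) (i : ℕ) : ℕ :=
  ∑ u ∈ (factors w).filter (fun u => u.length = i), (rightValence w u - 1)

theorem C_rec {A : Type*} [DecidableEq A] (w : List A) (i : ℕ) (hi : i ≤ w.length) :
    C w (i + 1) + (if K w ≤ i then 1 else 0) = C w i + exc w i := by
  rw [← card_zero w i hi, C_succ_sum, Finset.card_filter, ← Finset.sum_add_distrib]
  unfold C exc
  rw [Finset.card_eq_sum_ones, ← Finset.sum_add_distrib]
  refine Finset.sum_congr rfl ?_
  intro u _
  split_ifs <;> omega

theorem R_le {A : Type*} [DecidableEq A] (w : List A) (hw : w ≠ []) :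
    0 < R w ∧ R w ≤ w.length := by
  have h : w.length ∈ {r : ℕ | 0 < r ∧ ∀ u : List A, u.length = r → ¬ RightSpecial w u} := by
    refine ⟨List.length_pos_iff.2 hw, ?_⟩
    rintro u hu ⟨-, h2⟩
    have : rightValence w u = 0 := by
      rw [rv_zero_iff]
      intro x hx
      have := hx.length_le
      simp at this
      omega
    omega
  exact ⟨(Nat.sInf_mem ⟨_, h⟩).1, Nat.sInf_le h⟩

theorem exc_ge {A : Type*} [DecidableEq A] (w : List A) (i : ℕ) (hi : 0 < i) :
    (if i < R w then 1 else 0) ≤ exc w i := by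
  split_ifs with h
  · have := Nat.notMem_of_lt_sInf h
    simp only [Set.mem_ofPred_eq, not_and, not_forall, not_not] at this
    obtain ⟨u, hu, hf, h2⟩ := this hi
    have hm : u ∈ (factors w).filter (fun u => u.length = i) := by
      simp [mem_factors_iff, hu, hf]
    have h3 := Finset.single_le_sum (f := fun u => rightValence w u - 1)
      (fun _ _ => Nat.zero_le _) hm
    unfold exc
    omega
  · exact Nat.zero_le _

theorem C_one {A : Type*} [DecidableEq A] (w : List A) : C w 1 = (Alph w).card := by
  have h := C_succ_sum w 0
  have : (factors w).filter (fun u => u.length = 0) = {[]} := by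
    ext u
    simp only [Finset.mem_filter, mem_factors_iff, Finset.mem_singleton,
      List.length_eq_zero_iff]
    constructor
    · exact fun h => h.2
    · rintro rfl; exact ⟨List.nil_infix, rfl⟩
  rw [this, Finset.sum_singleton] at h
  rw [h]
  unfold rightValence
  congr 1
  rw [Finset.filter_eq_self]
  intro x hx
  unfold Alph at hx
  rw [List.mem_toFinset] at hx
  obtain ⟨s, t, rfl⟩ := List.append_of_mem hx
  exact ⟨s, t, by simp⟩

theorem C_last {A : Type*} [DecidableEq A] (w : List A) : C w (w.length + 1) = 0 := by
  unfold C
  rw [Finset.card_eq_zero, Finset.filter_eq_empty_iff]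
  intro u hu h
  rw [mem_factors_iff] at hu
  have := hu.length_le
  omega

theorem stmt1 (w : List A) (hw : w ≠ [])
    (h : w.length + 2 = R w + K w + (Alph w).card) : IsGT w := by
  have hK := K_pos w hw
  have hKn := (K_mem w).2
  obtain ⟨hR, hRn⟩ := R_le w hw
  have s1 : ∀ n, ∑ j ∈ Finset.range n, (if j + 1 < R w then 1 else 0) = min n (R w - 1) := by
    intro n
    induction n with
    | zero => simp
    | succ n ih => rw [Finset.sum_range_succ, ih]; split_ifs <;> omega
  have s2 : ∀ n, n ≤ w.length →
      ∑ j ∈ Finset.range n, exc w (j + 1) + C w 1 = C w (n + 1) + (n + 1 - K w) := by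
    intro n
    induction n with
    | zero => intro _; simp; omega
    | succ n ih =>
      intro hn
      have h1 := ih (by omega)
      have h2 := C_rec w (n + 1) hn
      rw [Finset.sum_range_succ]
      split_ifs at h2 <;> omega
  have hle : ∀ j ∈ Finset.range w.length, (if j + 1 < R w then 1 else 0) ≤ exc w (j + 1) :=
    fun j _ => exc_ge w (j + 1) (by omega)
  have heq : ∑ j ∈ Finset.range w.length, (if j + 1 < R w then 1 else 0)
      = ∑ j ∈ Finset.range w.length, exc w (j + 1) := by
    have h1 := s1 w.length
    have h2 := s2 w.length le_rfl
    rw [C_last, C_one] at h2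
    omega
  have hall := (Finset.sum_eq_sum_iff_of_le hle).1 heq
  have hrec : ∀ i, 1 ≤ i → i ≤ w.length →
      C w (i + 1) + (if K w ≤ i then 1 else 0) = C w i + (if i < R w then 1 else 0) := by
    intro i h1 h2
    have h3 := hall (i - 1) (Finset.mem_range.2 (by omega))
    rw [Nat.sub_add_cancel h1] at h3
    rw [h3]
    exact C_rec w i h2
  refine ⟨hw, Or.inr ⟨min (R w) (K w), max (R w) (K w), by omega, by omega, ?_, ?_, ?_⟩⟩
  · intro i h1
    induction i, h1 using Nat.le_induction with
    | base => intro _; rw [C_one]; omega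
    | succ i h1 ih =>
      intro h2
      have h3 := ih (by omega)
      have h4 := hrec i h1 (by omega)
      rw [if_neg (by omega), if_pos (by omega)] at h4
      omega
  · intro i h1 h2
    have h4 := hrec i (by omega) (by omega)
    split_ifs at h4 <;> omega
  · intro i h1 h2
    have h4 := hrec i (by omega) (by omega)
    split_ifs at h4 <;> omega
end

section
/- Let w be a finite word with |Alph(w)| ≥ 2. Then |w| + 2 = L_w + H_w + |Alph(w)| if and only if for every non-negative integer i < L_w there exists exactly one left special factor of w of length i, and every nonempty left special factor of w has left-valence exactly 2. -/
open List

variable {A : Type*} [DecidableEq A]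

theorem aux_mem_factors (w u : List A) : u ∈ factors w ↔ u <:+: w := by
  unfold factors
  simp only [Finset.mem_image, Finset.mem_product, Finset.mem_range, Prod.exists]
  constructor
  · rintro ⟨a, b, _, rfl⟩
    exact (List.take_prefix _ _).isInfix.trans (List.drop_suffix _ _).isInfix
  · rintro ⟨s, t, rfl⟩
    refine ⟨s.length, u.length, ?_, by simp⟩
    simp only [List.length_append]
    omega

/-- factors of length n -/
def auxF (w : List A) (n : ℕ) : Finset (List A) := (factors w).filter (fun u => u.length = n)

theorem aux_mem_F (w u : List A) (n : ℕ) : u ∈ auxF w n ↔ u <:+: w ∧ u.length = n := by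
  simp [auxF, aux_mem_factors]

theorem aux_lv_pos (w u : List A) : leftValence w u ≠ 0 ↔ ∃ x, x :: u <:+: w := by
  unfold leftValence Alph
  rw [Finset.card_ne_zero]
  constructor
  · rintro ⟨x, hx⟩
    exact ⟨x, (Finset.mem_filter.1 hx).2⟩
  · rintro ⟨x, hx⟩
    exact ⟨x, Finset.mem_filter.2 ⟨by simpa using hx.subset (by simp), hx⟩⟩

theorem aux_fiber (w : List A) (n : ℕ) :
    (auxF w (n+1)).card = ∑ u ∈ auxF w n, leftValence w u := by
  rw [Finset.card_eq_sum_card_fiberwise (f := List.tail) (t := auxF w n)]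
  · refine Finset.sum_congr rfl fun u hu => ?_
    rw [aux_mem_F] at hu
    unfold leftValence Alph
    rw [← Finset.card_image_of_injective (f := fun x => x :: u) _
      (fun a b h => (List.cons.inj h).1)]
    congr 1
    ext v
    simp only [Finset.mem_filter, aux_mem_F, Finset.mem_image, List.mem_toFinset]
    constructor
    · rintro ⟨⟨h1, h2⟩, h3⟩
      cases v with
      | nil => simp at h2
      | cons x v =>
        simp only [List.tail_cons] at h3
        subst h3
        exact ⟨x, ⟨h1.subset (by simp), h1⟩, rfl⟩
    · rintro ⟨x, ⟨h1, h2⟩, rfl⟩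
      simp [h2, hu.2]
  · intro v hv
    have hv := (aux_mem_F _ _ _).1 (Finset.mem_coe.1 hv)
    refine Finset.mem_coe.2 ((aux_mem_F _ _ _).2 ⟨(List.tail_suffix v).isInfix.trans hv.1, ?_⟩)
    simp [hv.2]

theorem aux_occ (w : List A) (k : ℕ) (hk : k ≤ w.length) :
    occCount w (w.take k) = 1 ↔ leftValence w (w.take k) = 0 := by
  have hl : (w.take k).length = k := by simp [hk]
  have h0 : 0 ∈ (Finset.range (w.length + 1)).filter
    (fun i => i + (w.take k).length ≤ w.length ∧
      (w.drop i).take (w.take k).length = w.take k) := by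
    simp [hk]
  unfold occCount
  constructor
  · intro h
    by_contra hne
    obtain ⟨x, s, t, hx⟩ := (aux_lv_pos _ _).1 hne
    have h1 : s.length + 1 ∈ (Finset.range (w.length + 1)).filter
      (fun i => i + (w.take k).length ≤ w.length ∧
        (w.drop i).take (w.take k).length = w.take k) := by
      have hlen := congrArg List.length hx
      simp only [List.length_append, List.length_cons] at hlen
      rw [Finset.mem_filter, Finset.mem_range]
      refine ⟨by omega, by omega, ?_⟩
      generalize w.take k = u at *
      subst hx
      have hd : drop (s.length + 1) s = [] := List.drop_eq_nil_of_le (by omega)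
      simp [List.drop_append, hd]
    have := Finset.card_le_one.1 h.le _ h0 _ h1
    omega
  · intro h
    rw [Finset.card_eq_one]
    refine ⟨0, Finset.eq_singleton_iff_unique_mem.2 ⟨h0, ?_⟩⟩
    intro i hi
    by_contra hne
    rw [Finset.mem_filter, Finset.mem_range] at hi
    obtain ⟨hi1, hi2, hi3⟩ := hi
    refine (aux_lv_pos _ _).2 ?_ h
    obtain ⟨j, rfl⟩ := Nat.exists_eq_succ_of_ne_zero hne
    have hj : j < w.length := by omega
    refine ⟨w[j], ?_⟩
    rw [← hi3]
    have : w[j] :: (w.drop (j+1)).take (w.take k).length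
        = (w.drop j).take ((w.take k).length + 1) := by
      rw [List.drop_eq_getElem_cons hj, List.take_succ_cons]
    rw [Nat.succ_eq_add_one, this]
    exact (List.take_prefix _ _).isInfix.trans (List.drop_suffix _ _).isInfix

theorem aux_lv_full (w u : List A) (h : w.length ≤ u.length) : leftValence w u = 0 := by
  by_contra hne
  obtain ⟨x, hx⟩ := (aux_lv_pos _ _).1 hne
  have := hx.length_le
  simp at this
  omega

theorem aux_H_mem (w : List A) :
    H w ≤ w.length ∧ leftValence w (w.take (H w)) = 0 := by
  have hne : {k : ℕ | ∃ u : List A, u <+: w ∧ u.length = k ∧ occCount w u = 1}.Nonempty := by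
    refine ⟨w.length, w, List.prefix_rfl, rfl, ?_⟩
    have := (aux_occ w w.length le_rfl).2 (aux_lv_full _ _ (by simp))
    simpa using this
  obtain ⟨u, hu, hl, ho⟩ := Nat.sInf_mem hne
  change u.length = H w at hl
  have hle : H w ≤ w.length := hl ▸ hu.length_le
  have hu' : u = w.take (H w) := by rw [← hl]; exact List.prefix_iff_eq_take.1 hu
  refine ⟨hle, (aux_occ w _ hle).1 (hu' ▸ ho)⟩

theorem aux_H_iff (w : List A) (n : ℕ) (hn : n ≤ w.length) :
    leftValence w (w.take n) = 0 ↔ H w ≤ n := by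
  constructor
  · intro h
    exact Nat.sInf_le ⟨w.take n, List.take_prefix _ _, by simp [hn], (aux_occ w n hn).2 h⟩
  · intro h
    by_contra hne
    obtain ⟨x, hx⟩ := (aux_lv_pos _ _).1 hne
    refine (aux_lv_pos _ _).2 ⟨x, ?_⟩ (aux_H_mem w).2
    refine List.IsInfix.trans (List.IsPrefix.isInfix ?_) hx
    rw [List.cons_prefix_cons]
    exact ⟨rfl, List.take_prefix_take_left h⟩

theorem aux_Z (w : List A) (n : ℕ) (hn : n ≤ w.length) :
    ((auxF w n).filter (fun u => leftValence w u = 0)).card = if H w ≤ n then 1 else 0 := by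
  have key : (auxF w n).filter (fun u => leftValence w u = 0)
      = ({w.take n} : Finset (List A)).filter (fun u => leftValence w u = 0) := by
    ext u
    simp only [Finset.mem_filter, aux_mem_F, Finset.mem_singleton]
    refine and_congr_left fun h0 => ⟨?_, ?_⟩
    · rintro ⟨⟨s, t, hst⟩, hl⟩
      rcases List.eq_nil_or_concat s with rfl | ⟨s', x, rfl⟩
      · rw [← hl, ← hst]; simp
      · exact absurd h0 ((aux_lv_pos _ _).2 ⟨x, s', t, by simpa using hst⟩)
    · rintro rfl
      exact ⟨(List.take_prefix _ _).isInfix, by simp [hn]⟩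
  rw [key, Finset.filter_singleton]
  simp only [aux_H_iff w n hn]
  split_ifs <;> simp

/-- excess -/
def auxS (w : List A) (n : ℕ) : ℕ := ∑ u ∈ auxF w n, (leftValence w u - 1)

theorem aux_step (w : List A) (n : ℕ) (hn : n ≤ w.length) :
    (auxF w (n+1)).card + (if H w ≤ n then 1 else 0) = (auxF w n).card + auxS w n := by
  rw [← aux_Z w n hn, aux_fiber, Finset.card_filter, Finset.card_eq_sum_ones, auxS,
    ← Finset.sum_add_distrib, ← Finset.sum_add_distrib]
  refine Finset.sum_congr rfl fun u _ => ?_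
  split_ifs <;> omega

theorem aux_F0 (w : List A) : auxF w 0 = {[]} := by
  ext u
  simp only [aux_mem_F, Finset.mem_singleton, List.length_eq_zero_iff]
  exact ⟨fun h => h.2, fun h => ⟨h ▸ List.nil_infix, h⟩⟩

theorem aux_sum (w : List A) (n : ℕ) (hn : n ≤ w.length + 1) :
    (auxF w n).card + (n - H w) = 1 + ∑ i ∈ Finset.range n, auxS w i := by
  induction n with
  | zero => simp [aux_F0]
  | succ n ih =>
    have h1 := ih (by omega)
    have h2 := aux_step w n (by omega)
    rw [Finset.sum_range_succ]
    split_ifs at h2 <;> omega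

theorem aux_total (w : List A) :
    w.length = H w + ∑ i ∈ Finset.range (w.length + 1), auxS w i := by
  have h := aux_sum w (w.length + 1) le_rfl
  have h0 : auxF w (w.length + 1) = ∅ := by
    ext u
    simp only [aux_mem_F, Finset.notMem_empty, iff_false]
    rintro ⟨h1, h2⟩
    have := h1.length_le
    omega
  have := (aux_H_mem w).1
  rw [h0, Finset.card_empty] at h
  omega

theorem aux_lv_nil (w : List A) : leftValence w [] = (Alph w).card := by
  unfold leftValence
  congr 1
  refine Finset.filter_true_of_mem fun x hx => ?_
  obtain ⟨s, t, h⟩ := List.append_of_mem (List.mem_toFinset.1 hx)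
  exact ⟨s, t, by simp [h]⟩

theorem aux_LS_prefix (w u v : List A) (h : v <+: u) (hu : LeftSpecial w u) :
    LeftSpecial w v := by
  refine ⟨h.isInfix.trans hu.1, hu.2.trans (Finset.card_le_card fun x hx => ?_)⟩
  rw [Finset.mem_filter] at hx ⊢
  exact ⟨hx.1, List.IsInfix.trans (List.IsPrefix.isInfix (by simpa using h)) hx.2⟩

theorem aux_L_mem (w : List A) (h : w ≠ []) :
    0 < L w ∧ ∀ u : List A, u.length = L w → ¬ LeftSpecial w u := by
  have hne : {r : ℕ | 0 < r ∧ ∀ u : List A, u.length = r → ¬ LeftSpecial w u}.Nonempty :=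
    ⟨w.length, List.length_pos_iff.2 h, fun u hu hs => by
      have := aux_lv_full w u hu.ge
      have := hs.2
      omega⟩
  exact Nat.sInf_mem hne

theorem aux_L_le (w : List A) (h : w ≠ []) : L w ≤ w.length :=
  Nat.sInf_le ⟨List.length_pos_iff.2 h, fun u hu hs => by
      have := aux_lv_full w u hu.ge
      have := hs.2
      omega⟩

theorem aux_LS_lt (w u : List A) (h : w ≠ []) (hu : LeftSpecial w u) : u.length < L w := by
  by_contra hlt
  exact (aux_L_mem w h).2 (u.take (L w)) (by simp; omega)
    (aux_LS_prefix _ _ _ (List.take_prefix _ _) hu)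

theorem aux_LS_ex (w : List A) (n : ℕ) (h0 : 0 < n) (hn : n < L w) :
    ∃ u, u.length = n ∧ LeftSpecial w u := by
  by_contra hne
  push Not at hne
  have : L w ≤ n := Nat.sInf_le ⟨h0, fun u hu => hne u hu⟩
  omega

theorem aux_S_pos (w : List A) (n : ℕ) (h0 : 0 < n) (hn : n < L w) : 1 ≤ auxS w n := by
  obtain ⟨u, hu, hs⟩ := aux_LS_ex w n h0 hn
  have h1 : leftValence w u - 1 ≤ auxS w n :=
    Finset.single_le_sum (f := fun u => leftValence w u - 1) (fun _ _ => Nat.zero_le _)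
      ((aux_mem_F _ _ _).2 ⟨hs.1, hu⟩)
  have := hs.2
  omega

theorem aux_S_one (w : List A) (n : ℕ) :
    auxS w n = 1 ↔ (∃! u : List A, u.length = n ∧ LeftSpecial w u) ∧
      ∀ u : List A, u.length = n → LeftSpecial w u → leftValence w u = 2 := by
  constructor
  · intro h
    have hex : ∃ u ∈ auxF w n, leftValence w u - 1 ≠ 0 := by
      apply Finset.exists_ne_zero_of_sum_ne_zero
      change auxS w n ≠ 0
      omega
    obtain ⟨u, hu, hne⟩ := hex
    have hsplit := Finset.add_sum_erase (auxF w n) (fun u => leftValence w u - 1) hu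
    change _ = auxS w n at hsplit
    have hz : ∑ v ∈ (auxF w n).erase u, (leftValence w v - 1) = 0 := by
      omega
    have hu2 : leftValence w u = 2 := by
      omega
    have hall : ∀ v : List A, v.length = n → LeftSpecial w v → v = u := by
      intro v hv hs
      by_contra hvu
      have := Finset.sum_eq_zero_iff.1 hz v
        (Finset.mem_erase.2 ⟨hvu, (aux_mem_F _ _ _).2 ⟨hs.1, hv⟩⟩)
      have := hs.2
      omega
    have hu' := (aux_mem_F _ _ _).1 hu
    refine ⟨⟨u, ⟨hu'.2, hu'.1, hu2.ge⟩, fun v hv => hall v hv.1 hv.2⟩, ?_⟩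
    intro v hv hs
    rw [hall v hv hs, hu2]
  · rintro ⟨⟨u, ⟨hu, hs⟩, huniq⟩, h2⟩
    have hu2 := h2 u hu hs
    unfold auxS
    rw [Finset.sum_eq_single_of_mem u ((aux_mem_F _ _ _).2 ⟨hs.1, hu⟩), hu2]
    intro v hv hvu
    have hv' := (aux_mem_F _ _ _).1 hv
    by_contra hne
    exact hvu (huniq v ⟨hv'.2, hv'.1, by omega⟩)

theorem stmt3 (w : List A) (h2 : 2 ≤ (Alph w).card) :
    w.length + 2 = L w + H w + (Alph w).card ↔
      ((∀ i : ℕ, i < L w → ∃! u : List A, u.length = i ∧ LeftSpecial w u) ∧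
       (∀ u : List A, u ≠ [] → LeftSpecial w u → leftValence w u = 2)) := by
  have hw : w ≠ [] := by
    rintro rfl
    simp [Alph] at h2
  have hL := aux_L_mem w hw
  have hLle := aux_L_le w hw
  have htot := aux_total w
  have hS0 : auxS w 0 = (Alph w).card - 1 := by
    simp [auxS, aux_F0, aux_lv_nil]
  have hsum : ∑ i ∈ Finset.range (w.length + 1), auxS w i
      = auxS w 0 + ∑ i ∈ Finset.Ico 1 (L w), auxS w i := by
    have e : ∑ i ∈ Finset.range (w.length + 1), auxS w i
        = ∑ i ∈ Finset.range (L w), auxS w i := by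
      symm
      apply Finset.sum_subset
      · intro i hi
        simp only [Finset.mem_range] at hi ⊢
        omega
      · intro i _ hi
        apply Finset.sum_eq_zero
        intro u hu
        by_contra hne
        have hu' := (aux_mem_F _ _ _).1 hu
        have := aux_LS_lt w u hw ⟨hu'.1, by omega⟩
        simp only [Finset.mem_range] at hi
        omega
    rw [e, Finset.range_eq_Ico, Finset.sum_eq_sum_Ico_succ_bot hL.1]
  have hone : ∑ i ∈ Finset.Ico 1 (L w), 1 = L w - 1 := by simp
  have hiff : (∑ i ∈ Finset.Ico 1 (L w), 1 = ∑ i ∈ Finset.Ico 1 (L w), auxS w i) ↔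
      ∀ i ∈ Finset.Ico 1 (L w), 1 = auxS w i := by
    apply Finset.sum_eq_sum_iff_of_le
    intro i hi
    rw [Finset.mem_Ico] at hi
    exact aux_S_pos w i hi.1 hi.2
  have hstart : w.length + 2 = L w + H w + (Alph w).card ↔
      ∑ i ∈ Finset.Ico 1 (L w), 1 = ∑ i ∈ Finset.Ico 1 (L w), auxS w i := by
    rw [hone]
    omega
  rw [hstart, hiff]
  constructor
  · intro h
    refine ⟨fun i hi => ?_, fun u hu hs => ?_⟩
    · rcases Nat.eq_zero_or_pos i with rfl | hpos
      · refine ⟨[], ⟨rfl, List.nil_infix, by rwa [aux_lv_nil]⟩, fun v hv => ?_⟩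
        exact List.length_eq_zero_iff.1 hv.1
      · exact ((aux_S_one w i).1 (h i (Finset.mem_Ico.2 ⟨hpos, hi⟩)).symm).1
    · have hlt := aux_LS_lt w u hw hs
      exact ((aux_S_one w u.length).1
        (h _ (Finset.mem_Ico.2 ⟨List.length_pos_iff.2 hu, hlt⟩)).symm).2 u rfl hs
  · rintro ⟨ha, hb⟩ i hi
    rw [Finset.mem_Ico] at hi
    refine ((aux_S_one w i).2 ⟨ha i hi.2, fun u hu hs => hb u ?_ hs⟩).symm
    rintro rfl
    simp at hu
    omega
end
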